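/- Let H be an elementary abelian 2-hypergroup built from p involutions, p♯ of which are thick, and let G be a closed subset of H. Then the automorphism group of G satisfies Aut(G) ≅ S_{s(G)} × GL(r_2(G), 2), and in particular Aut(H) ≅ S_{p♯} × GL(p − p♯, 2), where S_n denotes the symmetric group on n letters and GL(n, 2) the general linear group of degree n over the field of 2 elements. -/

import Mathlib

namespace HyperPaper

/-- A hypergroup: hypermultiplication `hmul`, inversion `star`, identity `e`,
satisfying (H1) associativity, (H2) unique two-sided identity, (H3) exchange conditions. -/
structure Hypergroup (H : Type*) where
  hmul : H → H → Set H
  star : H → H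
  e : H
  idl : ∀ p, hmul e p = {p}
  idr : ∀ p, hmul p e = {p}
  e_unique : ∀ e' : H, (∀ p, hmul e' p = {p} ∧ hmul p e' = {p}) → e' = e
  assoc : ∀ p q r : H, (⋃ x ∈ hmul p q, hmul x r) = ⋃ x ∈ hmul q r, hmul p x
  h3l : ∀ p q r : H, p ∈ hmul q r ↔ q ∈ hmul p (star r)
  h3r : ∀ p q r : H, p ∈ hmul q r ↔ r ∈ hmul (star q) p

variable {H : Type*}

namespace Hypergroup

/-- Product of two subsets: FG = {a : ∃ b ∈ F, c ∈ G, a ∈ bc}. -/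
def smul (hg : Hypergroup H) (F G : Set H) : Set H :=
  {a | ∃ b ∈ F, ∃ c ∈ G, a ∈ hg.hmul b c}

/-- Closed subset: nonempty and G*G ⊆ G. -/
def IsClosed (hg : Hypergroup H) (G : Set H) : Prop :=
  G.Nonempty ∧ hg.smul (hg.star '' G) G ⊆ G

/-- Thin element: p*p = {e}. -/
def IsThin (hg : Hypergroup H) (p : H) : Prop := hg.hmul (hg.star p) p = {hg.e}

/-- Thick element: not thin. -/
def IsThick (hg : Hypergroup H) (p : H) : Prop := ¬ hg.IsThin p

/-- Involution: p ≠ e and {e, p} is closed. -/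
def IsInvolution (hg : Hypergroup H) (p : H) : Prop :=
  p ≠ hg.e ∧ hg.IsClosed {hg.e, p}

/-- ⟨G⟩: smallest closed subset containing G. -/
def gen (hg : Hypergroup H) (G : Set H) : Set H := ⋂₀ {C | hg.IsClosed C ∧ G ⊆ C}

/-- O_ϑ(G): the thin elements of H lying in G. -/
def Othin (hg : Hypergroup H) (G : Set H) : Set H := {p ∈ G | hg.IsThin p}

/-- F is a strongly normal closed subset of G: p*Fp ⊆ F ⊆ G for all p ∈ G. -/
def IsStronglyNormal (hg : Hypergroup H) (F G : Set H) : Prop :=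
  hg.IsClosed F ∧ hg.IsClosed G ∧ F ⊆ G ∧
    ∀ p ∈ G, hg.smul (hg.smul {hg.star p} F) {p} ⊆ F

/-- O^ϑ(G): intersection of all strongly normal closed subsets of ⟨G⟩. -/
def Osup (hg : Hypergroup H) (G : Set H) : Set H :=
  ⋂₀ {F | hg.IsStronglyNormal F (hg.gen G)}

/-- F is a normal closed subset of G. -/
def IsNormal (hg : Hypergroup H) (F G : Set H) : Prop :=
  hg.IsClosed F ∧ hg.IsClosed G ∧ F ⊆ G ∧ ∀ p ∈ G, hg.smul F {p} = hg.smul {p} F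

/-- Product of a list of subsets (empty product is {e}). -/
def listProd (hg : Hypergroup H) : List (Set H) → Set H
  | [] => {hg.e}
  | a :: l => hg.smul a (hg.listProd l)

/-- Product r_1 r_2 ⋯ r_n of a family of elements. -/
def famProd (hg : Hypergroup H) {n : ℕ} (r : Fin n → H) : Set H :=
  hg.listProd ((List.finRange n).map fun i => ({r i} : Set H))

/-- Ĝ_i: the product of the G_j with j ≠ i. -/
def cofactor (hg : Hypergroup H) {n : ℕ} (G : Fin n → Set H) (i : Fin n) : Set H :=
  hg.listProd (((List.finRange n).filter fun j => decide (j ≠ i)).map G)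

/-- H is the direct product of the normal closed subsets G_1, …, G_n. -/
def IsDirectProduct (hg : Hypergroup H) {n : ℕ} (G : Fin n → Set H) : Prop :=
  (∀ i, hg.IsNormal (G i) Set.univ) ∧
  (∀ i, hg.smul (G i) (hg.cofactor G i) = Set.univ) ∧
  (∀ i, G i ∩ hg.cofactor G i = {hg.e})

/-- r : Fin n → H is a decomposition of x with respect to the family G. -/
def IsDecomp (hg : Hypergroup H) {n : ℕ} (G : Fin n → Set H) (x : H) (r : Fin n → H) : Prop :=
  (∀ i, r i ∈ G i) ∧ x ∈ hg.famProd r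

/-- The support of x: the elements ≠ e appearing in the decomposition of x. -/
def dsupport (hg : Hypergroup H) {n : ℕ} (G : Fin n → Set H) (x : H) : Set H :=
  {y | y ≠ hg.e ∧ ∃ r, hg.IsDecomp G x r ∧ y ∈ Set.range r}

/-- The cover of x: the product r_1r_2⋯r_n for the decomposition of x. -/
def dcover (hg : Hypergroup H) {n : ℕ} (G : Fin n → Set H) (x : H) : Set H :=
  {y | ∃ r, hg.IsDecomp G x r ∧ y ∈ hg.famProd r}

/-- x is constrained: its cover equals {x}. -/
def IsConstrained (hg : Hypergroup H) {n : ℕ} (G : Fin n → Set H) (x : H) : Prop :=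
  hg.dcover G x = {x}

/-- r_2(G): the largest 2-rank of a thin closed subset of H contained in G
(equivalently, the largest k such that G contains a thin symmetric closed subset
of 2^k elements, which corresponds to an elementary abelian 2-group of 2-rank k). -/
noncomputable def rank2 (hg : Hypergroup H) (G : Set H) : ℕ :=
  sSup {k | ∃ U : Set H, hg.IsClosed U ∧ U ⊆ G ∧ (∀ u ∈ U, hg.IsThin u) ∧
    (∀ u ∈ U, hg.star u = u) ∧ U.ncard = 2 ^ k}

/-- F is a minimal generating subset of G. -/
def IsMinGen (hg : Hypergroup H) (G F : Set H) : Prop :=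
  F ⊆ G ∧ hg.gen F = G ∧ ∀ p ∈ F, hg.gen (F \ {p}) ≠ G

/-- The dimension of G: the smallest cardinality of a minimal generating subset. -/
noncomputable def dimension (hg : Hypergroup H) (G : Set H) : ℕ :=
  sInf {k | ∃ F : Set H, hg.IsMinGen G F ∧ F.Finite ∧ F.ncard = k}

/-- [F, G] = ⟨{a : ∃ b ∈ F, c ∈ G, a ∈ b*c*bc}⟩. -/
def commSet (hg : Hypergroup H) (F G : Set H) : Set H :=
  hg.gen {a | ∃ b ∈ F, ∃ c ∈ G,
    a ∈ hg.smul (hg.smul (hg.smul {hg.star b} {hg.star c}) {b}) {c}}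

/-- derived G k = G^{(k+1)}: G^{(1)} = G, G^{(r)} = [G^{(r-1)}, G]. -/
def derived (hg : Hypergroup H) (G : Set H) : ℕ → Set H
  | 0 => G
  | k + 1 => hg.commSet (hg.derived G k) G

/-- G is nilpotent: G^{(r)} = {e} for some r. -/
def IsNilpotent (hg : Hypergroup H) (G : Set H) : Prop :=
  ∃ k : ℕ, hg.derived G k = {hg.e}

/-- G is a residually thin closed subset: there is a chain {e} = F_1, …, F_n = G of
pairwise distinct closed subsets, each strongly normal in the next. -/
def IsResiduallyThin (hg : Hypergroup H) (G : Set H) : Prop :=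
  ∃ (m : ℕ) (F : Fin (m + 1) → Set H), Function.Injective F ∧
    F 0 = {hg.e} ∧ F (Fin.last m) = G ∧
    ∀ i : Fin m, hg.IsStronglyNormal (F i.castSucc) (F i.succ)

/-- x^k as a subset: x^0 = {e}, x^{k+1} = x^k · x. -/
def spow (hg : Hypergroup H) (x : H) : ℕ → Set H
  | 0 => {hg.e}
  | k + 1 => hg.smul (hg.spow x k) {x}

/-- F is a maximal closed subset of G. -/
def IsMaximalClosed (hg : Hypergroup H) (F G : Set H) : Prop :=
  hg.IsClosed F ∧ hg.IsClosed G ∧ F ⊆ G ∧ F ≠ G ∧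
    ∀ E : Set H, hg.IsClosed E → F ⊆ E → E ⊆ G → E = F ∨ E = G

/-- The Frattini closed subset of G: the intersection (inside G) of all maximal
closed subsets of G. -/
def frattini (hg : Hypergroup H) (G : Set H) : Set H :=
  G ∩ ⋂₀ {F | hg.IsMaximalClosed F G}

/-- α is an isomorphism from the closed subset F to the closed subset G. -/
def IsIso (hg : Hypergroup H) (F G : Set H) (α : H → H) : Prop :=
  Set.BijOn α F G ∧ α hg.e = hg.e ∧
    ∀ p ∈ F, ∀ q ∈ F, α '' hg.hmul p q = hg.hmul (α p) (α q)

/-- F ≃ G: there is an isomorphism from F to G. -/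
def Isomorphic (hg : Hypergroup H) (F G : Set H) : Prop := ∃ α : H → H, hg.IsIso F G α

/-- Aut(G): the automorphism group of G, realized as the subgroup of permutations of G
that fix e and preserve the hypermultiplication. -/
def autGroup (hg : Hypergroup H) (G : Set H) : Subgroup (Equiv.Perm G) where
  carrier := {σ | (∀ x : G, (x : H) = hg.e → ((σ x : H)) = hg.e) ∧
    ∀ p q x : G, (x : H) ∈ hg.hmul p q ↔ ((σ x : H)) ∈ hg.hmul (σ p) (σ q)}
  one_mem' := by
    constructor
    · intro x hx; simpa using hx
    · intro p q x; simp
  mul_mem' := by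
    rintro σ τ ⟨he1, hm1⟩ ⟨he2, hm2⟩
    refine ⟨fun x hx => ?_, fun p q x => ?_⟩
    · simpa using he1 _ (he2 x hx)
    · simpa using (hm2 p q x).trans (hm1 (τ p) (τ q) (τ x))
  inv_mem' := by
    rintro σ ⟨he, hm⟩
    refine ⟨fun x hx => ?_, fun p q x => ?_⟩
    · have h2 : σ x = x := Subtype.ext ((he x hx).trans hx.symm)
      have h3 : σ⁻¹ x = x := by
        conv_lhs => rw [← h2]
        simp
      rw [h3]; exact hx
    · have h := hm (σ⁻¹ p) (σ⁻¹ q) (σ⁻¹ x)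
      simpa using h.symm

end Hypergroup

/-- An elementary abelian 2-hypergroup: a hypergroup that is the constrained direct
product of the closed subsets ⟨q_1⟩, …, ⟨q_n⟩ generated by involutions q_1, …, q_n. -/
structure EA2Data (H : Type*) where
  hg : Hypergroup H
  n : ℕ
  q : Fin n → H
  invol : ∀ i, hg.IsInvolution (q i)
  dp : hg.IsDirectProduct fun i => hg.gen {q i}
  constrained : ∀ x : H, hg.IsConstrained (fun i => hg.gen {q i}) x

namespace EA2Data

/-- The family ⟨q_1⟩, …, ⟨q_n⟩. -/
def fam (E : EA2Data H) : Fin E.n → Set H := fun i => E.hg.gen {E.q i}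

/-- The support of x. -/
def support (E : EA2Data H) (x : H) : Set H := E.hg.dsupport E.fam x

/-- Thick(F): externally thick elements of H lying in F. -/
def ThickIn (E : EA2Data H) (F : Set H) : Set H :=
  {x ∈ F | x = E.hg.e ∨ ∀ y ∈ E.support x, E.hg.IsThick y}

/-- Thin(F): externally thin elements of H lying in F. -/
def ThinIn (E : EA2Data H) (F : Set H) : Set H :=
  {x ∈ F | x = E.hg.e ∨ ∀ y ∈ E.support x, E.hg.IsThin y}

/-- The (unique) pair (x⁺, x⁻) with x⁺ ∈ Thick(H), x⁻ ∈ Thin(H), x⁺x⁻ = {x}. -/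
noncomputable def pm (E : EA2Data H) (x : H) : H × H :=
  @Classical.epsilon (H × H) ⟨(E.hg.e, E.hg.e)⟩ fun z =>
    z.1 ∈ E.ThickIn Set.univ ∧ z.2 ∈ E.ThinIn Set.univ ∧ E.hg.hmul z.1 z.2 = {x}

/-- x⁺. -/
noncomputable def plus (E : EA2Data H) (x : H) : H := (E.pm x).1

/-- x⁻. -/
noncomputable def minus (E : EA2Data H) (x : H) : H := (E.pm x).2

/-- s(x): the number of thick elements of H in the support of x. -/
noncomputable def sElem (E : EA2Data H) (x : H) : ℕ :=
  {y ∈ E.support x | E.hg.IsThick y}.ncard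

/-- s(G) = max {s(a) : a ∈ G}. -/
noncomputable def sSet (E : EA2Data H) (G : Set H) : ℕ :=
  sSup {k | ∃ a ∈ G, E.sElem a = k}

/-- x ⪯ y: the support of x is contained in the support of y. -/
def ple (E : EA2Data H) (x y : H) : Prop := E.support x ⊆ E.support y

/-- p♯: the number of thick elements among q_1, …, q_n. -/
noncomputable def psharp (E : EA2Data H) : ℕ := {i : Fin E.n | E.hg.IsThick (E.q i)}.ncard

end EA2Data

/-- The Gaussian binomial coefficient C(n, k)_2 with base 2, via the
q-Pascal recurrence C(n, k)_2 = C(n-1, k-1)_2 + 2^k · C(n-1, k)_2. -/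
def gaussBinom2 : ℕ → ℕ → ℕ
  | _, 0 => 1
  | 0, _ + 1 => 0
  | n + 1, k + 1 => gaussBinom2 n k + 2 ^ (k + 1) * gaussBinom2 n (k + 1)

end HyperPaper

open HyperPaper

namespace HyperPaper

namespace Hypergroup

variable {H : Type*} (hg : Hypergroup H)

theorem e_mem_star_mul (p : H) : hg.e ∈ hg.hmul (hg.star p) p :=
  (hg.h3r p p hg.e).1 (by rw [hg.idr]; rfl)

theorem e_mem_mul_star (p : H) : hg.e ∈ hg.hmul p (hg.star p) :=
  (hg.h3l p hg.e p).1 (by rw [hg.idl]; rfl)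

theorem e_mem_mul_iff {p q : H} : hg.e ∈ hg.hmul p q ↔ p = hg.star q := by
  rw [hg.h3l, hg.idl, Set.mem_singleton_iff]

theorem star_star (p : H) : hg.star (hg.star p) = p :=
  (hg.e_mem_mul_iff.1 (hg.e_mem_mul_star p)).symm

theorem star_e : hg.star hg.e = hg.e := by
  have h := hg.e_mem_star_mul hg.e
  rw [hg.idr] at h
  exact h.symm

theorem hmul_nonempty (p q : H) : (hg.hmul p q).Nonempty := by
  by_contra h
  rw [Set.not_nonempty_iff_eq_empty] at h
  have h1 : q ∈ ⋃ x ∈ hg.hmul (hg.star p) p, hg.hmul x q :=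
    Set.mem_biUnion (hg.e_mem_star_mul p) (by rw [hg.idl]; rfl)
  rw [hg.assoc, h] at h1
  simp at h1

theorem mul_assoc_mem {p q r a : H} :
    (∃ x ∈ hg.hmul p q, a ∈ hg.hmul x r) ↔ ∃ x ∈ hg.hmul q r, a ∈ hg.hmul p x := by
  have h := hg.assoc p q r
  have h' := Set.ext_iff.1 h a
  simpa using h'

theorem smul_assoc (A B C : Set H) : hg.smul (hg.smul A B) C = hg.smul A (hg.smul B C) := by
  ext x
  constructor
  · rintro ⟨y, ⟨a, ha, b, hb, hy⟩, c, hc, hx⟩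
    obtain ⟨z, hz, hx'⟩ := hg.mul_assoc_mem.1 ⟨y, hy, hx⟩
    exact ⟨a, ha, z, ⟨b, hb, c, hc, hz⟩, hx'⟩
  · rintro ⟨a, ha, z, ⟨b, hb, c, hc, hz⟩, hx⟩
    obtain ⟨y, hy, hx'⟩ := hg.mul_assoc_mem.2 ⟨z, hz, hx⟩
    exact ⟨y, ⟨a, ha, b, hb, hy⟩, c, hc, hx'⟩

theorem smul_e (A : Set H) : hg.smul A {hg.e} = A := by
  ext x
  simp [smul, hg.idr]

theorem e_smul (A : Set H) : hg.smul {hg.e} A = A := by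
  ext x
  simp [smul, hg.idl]

theorem smul_singleton (a b : H) : hg.smul {a} {b} = hg.hmul a b := by
  ext x
  simp [smul]

theorem smul_mono {A B C D : Set H} (h₁ : A ⊆ B) (h₂ : C ⊆ D) : hg.smul A C ⊆ hg.smul B D := by
  rintro x ⟨a, ha, c, hc, hx⟩
  exact ⟨a, h₁ ha, c, h₂ hc, hx⟩

theorem smul_nonempty {A B : Set H} (hA : A.Nonempty) (hB : B.Nonempty) :
    (hg.smul A B).Nonempty := by
  obtain ⟨a, ha⟩ := hA
  obtain ⟨b, hb⟩ := hB
  obtain ⟨x, hx⟩ := hg.hmul_nonempty a b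
  exact ⟨x, a, ha, b, hb, hx⟩

section ListProd

variable {ι : Type*}

theorem listProd_nonempty (l : List ι) (A : ι → Set H) (hA : ∀ i, (A i).Nonempty) :
    (hg.listProd (l.map A)).Nonempty := by
  induction l with
  | nil => exact ⟨hg.e, rfl⟩
  | cons i l ih => exact hg.smul_nonempty (hA i) ih

theorem listProd_mono (l : List ι) {A B : ι → Set H} (h : ∀ i, A i ⊆ B i) :
    hg.listProd (l.map A) ⊆ hg.listProd (l.map B) := by
  induction l with
  | nil => exact subset_rfl
  | cons i l ih => exact hg.smul_mono (h i) ih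

theorem e_mem_listProd (l : List ι) {A : ι → Set H} (h : ∀ i ∈ l, hg.e ∈ A i) :
    hg.e ∈ hg.listProd (l.map A) := by
  induction l with
  | nil => rfl
  | cons i l ih =>
    exact ⟨hg.e, h i (by simp), hg.e, ih fun j hj => h j (by simp [hj]), by rw [hg.idl]; rfl⟩

theorem subset_listProd {l : List ι} (hl : l.Nodup) {A : ι → Set H} {i : ι} (hi : i ∈ l)
    (h : ∀ j ∈ l, j ≠ i → hg.e ∈ A j) : A i ⊆ hg.listProd (l.map A) := by
  induction l with
  | nil => simp at hi
  | cons k l ih =>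
    rw [List.nodup_cons] at hl
    intro x hx
    by_cases hk : k = i
    · subst hk
      refine ⟨x, hx, hg.e, hg.e_mem_listProd l fun j hj => ?_, by rw [hg.idr]; rfl⟩
      exact h j (by simp [hj]) fun hjk => hl.1 (hjk ▸ hj)
    · have hil : i ∈ l := by
        rcases List.mem_cons.1 hi with h' | h'
        · exact absurd h'.symm hk
        · exact h'
      exact ⟨hg.e, h k (by simp) hk, x, ih hl.2 hil (fun j hj => h j (by simp [hj])) hx,
        by rw [hg.idl]; rfl⟩

theorem listProd_filter (l : List ι) (p : ι → Bool) (A : ι → Set H) :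
    hg.listProd ((l.filter p).map A) =
      hg.listProd (l.map fun i => if p i = true then A i else {hg.e}) := by
  induction l with
  | nil => rfl
  | cons i l ih =>
    by_cases hp : p i = true
    · simp [hp, listProd, ih]
    · simp [hp, listProd, ih, e_smul]

theorem listProd_smul_comm (l : List ι) {A : ι → Set H} {B : Set H}
    (h : ∀ i, hg.smul (A i) B = hg.smul B (A i)) :
    hg.smul (hg.listProd (l.map A)) B = hg.smul B (hg.listProd (l.map A)) := by
  induction l with
  | nil => exact (hg.e_smul B).trans (hg.smul_e B).symm
  | cons i l ih =>
    simp only [List.map_cons, listProd]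
    rw [smul_assoc, ih, ← smul_assoc, h, smul_assoc]

theorem smul_listProd (l : List ι) {A B : ι → Set H}
    (h : ∀ i j, hg.smul (A i) (B j) = hg.smul (B j) (A i)) :
    hg.smul (hg.listProd (l.map A)) (hg.listProd (l.map B)) =
      hg.listProd (l.map fun i => hg.smul (A i) (B i)) := by
  induction l with
  | nil => exact hg.e_smul _
  | cons i l ih =>
    simp only [List.map_cons, listProd]
    rw [smul_assoc, ← hg.smul_assoc _ (B i), hg.listProd_smul_comm l fun j => h j i,
      hg.smul_assoc (B i), ih, smul_assoc]

theorem mem_listProd_iff [DecidableEq ι] {l : List ι} (hl : l.Nodup) (A : ι → Set H)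
    (hA : ∀ i, (A i).Nonempty) (x : H) :
    x ∈ hg.listProd (l.map A) ↔
      ∃ r : ι → H, (∀ i, r i ∈ A i) ∧ x ∈ hg.listProd (l.map fun i => {r i}) := by
  refine ⟨fun hx => ?_, fun ⟨r, hr, hx⟩ => hg.listProd_mono l (by simpa using hr) hx⟩
  induction l generalizing x with
  | nil =>
    choose r hr using hA
    exact ⟨r, hr, hx⟩
  | cons k l ih =>
    rw [List.nodup_cons] at hl
    obtain ⟨a, ha, b, hb, hx⟩ := hx
    obtain ⟨r, hr, hb⟩ := ih hl.2 b hb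
    refine ⟨Function.update r k a, fun i => ?_, a, by simp, b, ?_, hx⟩
    · by_cases hi : i = k
      · subst hi; simpa using ha
      · simpa [hi] using hr i
    · have : (l.map fun i => ({Function.update r k a i} : Set H)) = l.map fun i => {r i} := by
        refine List.map_congr_left fun i hi => ?_
        rw [Function.update_of_ne (show i ≠ k from fun h => hl.1 (h ▸ hi))]
      rw [this]
      exact hb

end ListProd

section Closed

variable {hg} {G : Set H}

theorem IsClosed.e_mem (hG : hg.IsClosed G) : hg.e ∈ G := by
  obtain ⟨g, hgG⟩ := hG.1
  exact hG.2 ⟨hg.star g, ⟨g, hgG, rfl⟩, g, hgG, hg.e_mem_star_mul g⟩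

theorem IsClosed.star_mem (hG : hg.IsClosed G) {p : H} (hp : p ∈ G) : hg.star p ∈ G :=
  hG.2 ⟨hg.star p, ⟨p, hp, rfl⟩, hg.e, hG.e_mem, by rw [hg.idr]; rfl⟩

theorem IsClosed.mul_mem (hG : hg.IsClosed G) {p q x : H} (hp : p ∈ G) (hq : q ∈ G)
    (hx : x ∈ hg.hmul p q) : x ∈ G :=
  hG.2 ⟨p, ⟨hg.star p, hG.star_mem hp, hg.star_star p⟩, q, hq, hx⟩

theorem isClosed_gen (A : Set H) : hg.IsClosed (hg.gen A) := by
  refine ⟨⟨hg.e, fun C hC => hC.1.e_mem⟩, ?_⟩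
  rintro x ⟨_, ⟨p, hp, rfl⟩, q, hq, hx⟩ C hC
  exact hC.1.mul_mem (hC.1.star_mem (hp C hC)) (hq C hC) hx

end Closed

section Involution

variable {hg} {p : H}

theorem IsInvolution.gen_eq (hp : hg.IsInvolution p) : hg.gen {p} = {hg.e, p} := by
  apply subset_antisymm
  · exact Set.sInter_subset_of_mem ⟨hp.2, by simp⟩
  · rintro x (rfl | rfl)
    · exact (isClosed_gen _).e_mem
    · exact fun C hC => hC.2 rfl

theorem IsInvolution.star_eq (hp : hg.IsInvolution p) : hg.star p = p := by
  rcases hp.2.star_mem (p := p) (by simp) with h | h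
  · exact absurd (by rw [← hg.star_star p, h, star_e]) hp.1
  · exact h

theorem IsInvolution.mem_mul_self (hp : hg.IsInvolution p) {x : H} :
    x ∈ hg.hmul p p ↔ x = hg.e ∨ (hg.IsThick p ∧ x = p) := by
  have he : hg.e ∈ hg.hmul p p := hg.e_mem_mul_iff.2 hp.star_eq.symm
  have hsub : ∀ y ∈ hg.hmul p p, y = hg.e ∨ y = p := fun y hy =>
    hp.2.mul_mem (p := p) (q := p) (by simp) (by simp) hy
  by_cases ht : hg.IsThin p
  · have h : hg.hmul p p = {hg.e} := by
      have := ht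
      rwa [IsThin, hp.star_eq] at this
    simp [h, IsThick, ht]
  · have hpp : p ∈ hg.hmul p p := by
      by_contra h
      refine ht ?_
      rw [IsThin, hp.star_eq]
      ext y
      constructor
      · intro hy
        rcases hsub y hy with h' | h'
        · exact h'
        · exact absurd (h' ▸ hy) h
      · rintro rfl
        exact he
    constructor
    · intro hx
      exact (hsub x hx).imp_right fun h => ⟨ht, h⟩
    · rintro (rfl | ⟨-, rfl⟩)
      exacts [he, hpp]

end Involution

theorem hmul_comm_of_normal {F G : Set H} (hF : hg.IsNormal F Set.univ)
    (hG : hg.IsNormal G Set.univ) (hFG : F ∩ G ⊆ {hg.e}) {a b : H} (ha : a ∈ F) (hb : b ∈ G) :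
    hg.hmul a b = hg.hmul b a := by
  have key : ∀ {F G : Set H}, hg.IsNormal F Set.univ → hg.IsNormal G Set.univ →
      F ∩ G ⊆ {hg.e} → ∀ {a b : H}, a ∈ F → b ∈ G → hg.hmul a b ⊆ hg.hmul b a := by
    intro F G hF hG hFG a b ha hb x hx
    have h1 : x ∈ hg.smul G {a} := by
      rw [hG.2.2.2 a trivial]
      exact ⟨a, rfl, b, hb, hx⟩
    have h2 : x ∈ hg.smul {b} F := by
      rw [← hF.2.2.2 b trivial]
      exact ⟨a, ha, b, rfl, hx⟩
    obtain ⟨t, ht, _, rfl, hxt⟩ := h1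
    obtain ⟨_, rfl, s, hs, hxs⟩ := h2
    obtain ⟨y, hy, hty⟩ := hg.mul_assoc_mem.1 ⟨x, hxs, (hg.h3l _ _ _).1 hxt⟩
    have hyF : y ∈ F := hF.1.mul_mem hs (hF.1.star_mem ha) hy
    have hyG : y ∈ G := hG.1.mul_mem (hG.1.star_mem hb) ht ((hg.h3r _ _ _).1 hty)
    have hye : y = hg.e := hFG ⟨hyF, hyG⟩
    rw [hye, hg.idr] at hty
    rwa [← show t = _ from hty]
  exact subset_antisymm (key hF hG hFG ha hb) (key hG hF (by rwa [Set.inter_comm]) hb ha)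

end Hypergroup

namespace EA2Data

variable {H : Type*} (E : EA2Data H)

theorem mem_gen_iff (i : Fin E.n) (x : H) : x ∈ E.hg.gen {E.q i} ↔ x = E.hg.e ∨ x = E.q i := by
  rw [(E.invol i).gen_eq]
  rfl

theorem gen_subset_cofactor {i j : Fin E.n} (hij : j ≠ i) :
    E.hg.gen {E.q j} ⊆ E.hg.cofactor (fun i => E.hg.gen {E.q i}) i :=
  E.hg.subset_listProd (A := fun i => E.hg.gen {E.q i}) ((List.nodup_finRange _).filter _)
    (by simpa using hij) fun _ _ _ => (Hypergroup.isClosed_gen _).e_mem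

theorem hmul_comm_of_mem_gen {i j : Fin E.n} {a b : H} (ha : a ∈ E.hg.gen {E.q i})
    (hb : b ∈ E.hg.gen {E.q j}) : E.hg.hmul a b = E.hg.hmul b a := by
  by_cases hij : j = i
  · subst hij
    rw [mem_gen_iff] at ha hb
    rcases ha with rfl | rfl <;> rcases hb with rfl | rfl <;>
      simp [E.hg.idl, E.hg.idr]
  · refine E.hg.hmul_comm_of_normal (E.dp.1 i) (E.dp.1 j) ?_ ha hb
    rw [← E.dp.2.2 i]
    exact Set.inter_subset_inter_right _ (E.gen_subset_cofactor hij)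

open Classical in
/-- The family with entry `q i` where `v i = 1` and entry `e` elsewhere. -/
noncomputable def family (v : Fin E.n → ZMod 2) (i : Fin E.n) : H :=
  if v i = 1 then E.q i else E.hg.e

theorem family_mem_gen (v : Fin E.n → ZMod 2) (i : Fin E.n) : E.family v i ∈ E.hg.gen {E.q i} := by
  rw [mem_gen_iff, family]
  split_ifs <;> simp

theorem exists_family_eq {r : Fin E.n → H} (hr : ∀ i, r i ∈ E.hg.gen {E.q i}) :
    ∃ v, r = E.family v := by
  classical
  refine ⟨fun i => if r i = E.q i then 1 else 0, funext fun i => ?_⟩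
  rcases (E.mem_gen_iff i _).1 (hr i) with h | h
  · simp [family, h, (E.invol i).1.symm]
  · simp [family, h]

theorem exists_famProd_family (v : Fin E.n → ZMod 2) : ∃ x, E.hg.famProd (E.family v) = {x} := by
  obtain ⟨x, hx⟩ := E.hg.listProd_nonempty (List.finRange E.n) (fun i => {E.family v i})
    fun i => ⟨_, rfl⟩
  refine ⟨x, subset_antisymm (fun y hy => ?_) (Set.singleton_subset_iff.2 hx)⟩
  rw [← E.constrained x]
  exact ⟨_, ⟨E.family_mem_gen v, hx⟩, hy⟩

/-- The element of `H` with coordinate vector `v`. -/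
noncomputable def elt (v : Fin E.n → ZMod 2) : H := (E.exists_famProd_family v).choose

theorem famProd_family (v : Fin E.n → ZMod 2) : E.hg.famProd (E.family v) = {E.elt v} :=
  (E.exists_famProd_family v).choose_spec

theorem isDecomp_iff {x : H} {r : Fin E.n → H} :
    E.hg.IsDecomp (fun i => E.hg.gen {E.q i}) x r ↔ ∃ v, r = E.family v ∧ x = E.elt v := by
  constructor
  · rintro ⟨hr, hx⟩
    obtain ⟨v, rfl⟩ := E.exists_family_eq hr
    rw [famProd_family] at hx
    exact ⟨v, rfl, hx⟩
  · rintro ⟨v, rfl, rfl⟩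
    exact ⟨E.family_mem_gen v, by rw [famProd_family]; rfl⟩

theorem elt_surjective : Function.Surjective E.elt := by
  intro x
  have h : x ∈ E.hg.dcover (fun i => E.hg.gen {E.q i}) x := by
    rw [E.constrained x]; rfl
  obtain ⟨r, hr, -⟩ := h
  obtain ⟨v, -, rfl⟩ := E.isDecomp_iff.1 hr
  exact ⟨v, rfl⟩

theorem family_mem_hmul_iff (w u v : Fin E.n → ZMod 2) (i : Fin E.n) :
    E.family w i ∈ E.hg.hmul (E.family u i) (E.family v i) ↔
      w i = u i + v i ∨ (E.hg.IsThick (E.q i) ∧ u i = 1 ∧ v i = 1) := by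
  have two : ∀ a : ZMod 2, a = 0 ∨ a = 1 := by decide
  have h11 : (1 + 1 : ZMod 2) = 0 := by decide
  have hq := (E.invol i).1
  simp only [family]
  rcases two (w i) with hw | hw <;> rcases two (u i) with hu | hu <;>
    rcases two (v i) with hv | hv <;>
    simp [hw, hu, hv, h11, E.hg.idl, E.hg.idr, hq, hq.symm, (E.invol i).mem_mul_self]

theorem mem_hmul_elt_iff (x : H) (u v : Fin E.n → ZMod 2) :
    x ∈ E.hg.hmul (E.elt u) (E.elt v) ↔
      ∃ w, x = E.elt w ∧
        ∀ i, w i = u i + v i ∨ (E.hg.IsThick (E.q i) ∧ u i = 1 ∧ v i = 1) := by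
  have h : E.hg.hmul (E.elt u) (E.elt v) = E.hg.listProd ((List.finRange E.n).map fun i =>
      E.hg.hmul (E.family u i) (E.family v i)) := by
    simp only [← E.hg.smul_singleton]
    rw [← famProd_family, ← famProd_family, Hypergroup.famProd, Hypergroup.famProd,
      E.hg.smul_listProd]
    intro i j
    simp only [E.hg.smul_singleton]
    exact E.hmul_comm_of_mem_gen (E.family_mem_gen u i) (E.family_mem_gen v j)
  simp only [← E.family_mem_hmul_iff]
  rw [h, E.hg.mem_listProd_iff (List.nodup_finRange _) _ fun i => E.hg.hmul_nonempty _ _]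
  constructor
  · rintro ⟨r, hr, hx⟩
    obtain ⟨w, rfl, rfl⟩ := E.isDecomp_iff.1 ⟨fun i => (Hypergroup.isClosed_gen _).mul_mem
      (E.family_mem_gen u i) (E.family_mem_gen v i) (hr i), hx⟩
    exact ⟨w, rfl, hr⟩
  · rintro ⟨w, rfl, hw⟩
    exact ⟨_, hw, (E.isDecomp_iff.2 ⟨w, rfl, rfl⟩).2⟩

theorem elt_zero : E.elt 0 = E.hg.e := by
  have h : E.hg.e ∈ E.hg.famProd (E.family 0) :=
    E.hg.e_mem_listProd _ fun i _ => by simp [family]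
  rw [famProd_family] at h
  exact h.symm

theorem elt_single (i : Fin E.n) : E.elt (Pi.single i 1) = E.q i := by
  have h : ({E.family (Pi.single i 1) i} : Set H) ⊆ E.hg.famProd (E.family (Pi.single i 1)) :=
    E.hg.subset_listProd (A := fun j => {E.family (Pi.single i 1) j}) (List.nodup_finRange _)
      (List.mem_finRange i) fun j _ hj => by simp [family, hj]
  rw [famProd_family] at h
  simpa [family, eq_comm] using h

theorem star_elt (v : Fin E.n → ZMod 2) : E.hg.star (E.elt v) = E.elt v := by
  refine (E.hg.e_mem_mul_iff.1 ?_).symm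
  rw [mem_hmul_elt_iff]
  exact ⟨0, E.elt_zero.symm, fun i => .inl (CharTwo.add_self_eq_zero _).symm⟩

theorem elt_mem_cofactor {v : Fin E.n → ZMod 2} {i : Fin E.n} (hv : v i = 0) :
    E.elt v ∈ E.hg.cofactor (fun i => E.hg.gen {E.q i}) i := by
  have h : E.hg.famProd (E.family v) ⊆ E.hg.cofactor (fun i => E.hg.gen {E.q i}) i := by
    rw [Hypergroup.cofactor, Hypergroup.listProd_filter]
    refine E.hg.listProd_mono _ fun j => ?_
    by_cases hj : j = i
    · subst hj
      simp [family, hv]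
    · simpa [hj] using E.family_mem_gen v j
  rw [famProd_family] at h
  exact h rfl

theorem elt_injective : Function.Injective E.elt := by
  have two : ∀ a : ZMod 2, a = 0 ∨ a = 1 := by decide
  have key : ∀ u v i, E.elt u = E.elt v → u i = 1 → v i = 0 → False := by
    intro u v i huv hu hv
    have h1 : E.elt u ∈ E.hg.hmul (E.elt (Pi.single i 1)) (E.elt (Function.update u i 0)) := by
      rw [mem_hmul_elt_iff]
      refine ⟨u, rfl, fun j => .inl ?_⟩
      by_cases hj : j = i
      · subst hj; simp [hu]
      · simp [hj]
    rw [E.hg.h3l, star_elt, elt_single, huv, mem_hmul_elt_iff] at h1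
    obtain ⟨w, hw, hw'⟩ := h1
    have hwi : w i = 0 := by simpa [hv] using hw' i
    have hq : E.q i ∈ ({E.hg.e} : Set H) := by
      rw [← E.dp.2.2 i]
      exact ⟨(E.mem_gen_iff i _).2 (.inr rfl), hw ▸ E.elt_mem_cofactor hwi⟩
    exact (E.invol i).1 hq
  intro u v huv
  funext i
  rcases two (u i) with hu | hu <;> rcases two (v i) with hv | hv
  · rw [hu, hv]
  · exact (key v u i huv.symm hv hu).elim
  · exact (key u v i huv hu hv).elim
  · rw [hu, hv]

/-- The coordinate vectors over the field with two elements parametrize `H`. -/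
noncomputable def coord : (Fin E.n → ZMod 2) ≃ H :=
  Equiv.ofBijective E.elt ⟨E.elt_injective, E.elt_surjective⟩

theorem elt_mem_hmul_iff {w u v : Fin E.n → ZMod 2} :
    E.elt w ∈ E.hg.hmul (E.elt u) (E.elt v) ↔
      ∀ i, w i = u i + v i ∨ (E.hg.IsThick (E.q i) ∧ u i = 1 ∧ v i = 1) := by
  rw [mem_hmul_elt_iff]
  constructor
  · rintro ⟨w', hw, h⟩
    rwa [E.elt_injective hw]
  · exact fun h => ⟨w, rfl, h⟩

theorem q_injective : Function.Injective E.q := by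
  intro i j hij
  rw [← elt_single, ← elt_single] at hij
  have := congrFun (E.elt_injective hij) i
  by_contra h
  simp [h] at this

theorem support_elt (v : Fin E.n → ZMod 2) : E.support (E.elt v) = E.q '' {i | v i = 1} := by
  ext y
  constructor
  · rintro ⟨hy, r, hr, i, rfl⟩
    obtain ⟨w, rfl, hw⟩ := E.isDecomp_iff.1 hr
    rw [← E.elt_injective hw] at hy ⊢
    by_cases hi : v i = 1
    · exact ⟨i, hi, by simp [family, hi]⟩
    · simp [family, hi] at hy
  · rintro ⟨i, hi, rfl⟩
    have hi' : v i = 1 := hi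
    exact ⟨(E.invol i).1, _, E.isDecomp_iff.2 ⟨v, rfl, rfl⟩, i, by simp [family, hi']⟩

theorem isThin_elt_iff (v : Fin E.n → ZMod 2) :
    E.hg.IsThin (E.elt v) ↔ ∀ i, E.hg.IsThick (E.q i) → v i = 0 := by
  have two : ∀ a : ZMod 2, a = 0 ∨ a = 1 := by decide
  rw [Hypergroup.IsThin, star_elt]
  constructor
  · intro h i hi
    refine (two (v i)).resolve_right fun hv => (E.invol i).1 ?_
    have h1 : E.elt (Pi.single i 1) ∈ E.hg.hmul (E.elt v) (E.elt v) := by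
      rw [elt_mem_hmul_iff]
      intro j
      by_cases hj : j = i
      · subst hj; exact .inr ⟨hi, hv, hv⟩
      · left; simp [hj, CharTwo.add_self_eq_zero]
    rw [h, elt_single] at h1
    exact h1
  · intro h
    ext x
    obtain ⟨w, rfl⟩ := E.elt_surjective x
    rw [elt_mem_hmul_iff, Set.mem_singleton_iff, ← elt_zero, E.elt_injective.eq_iff, funext_iff]
    refine forall_congr' fun i => ?_
    simp only [CharTwo.add_self_eq_zero, Pi.zero_apply, or_iff_left_iff_imp]
    rintro ⟨hi, hv, -⟩
    simp [h i hi] at hv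

end EA2Data

end HyperPaper

namespace HyperPaper

section Model

/-- The relation `x ∈ pq` in the direct product of the hypergroup of subsets of `S`, generated
by thick involutions, and the elementary abelian 2-group `W`. -/
def ModelRel {S W : Type*} [Add W] (p q x : Set S × W) : Prop :=
  x.2 = p.2 + q.2 ∧ symmDiff p.1 q.1 ⊆ x.1 ∧ x.1 ⊆ p.1 ∪ q.1

theorem modelRel_mk {S W : Type*} [Add W] {A B C : Set S} {u v w : W} :
    ModelRel (A, u) (B, v) (C, w) ↔ w = u + v ∧ symmDiff A B ⊆ C ∧ C ⊆ A ∪ B := Iff.rfl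

theorem modelRel_empty {S W : Type*} [Add W] {u v : W} {x : Set S × W} :
    ModelRel (∅, u) (∅, v) x ↔ x = (∅, u + v) := by
  simp [ModelRel, Prod.ext_iff, and_comm]

theorem modelRel_set_vec {S W : Type*} [AddMonoid W] {A : Set S} {u : W} {x : Set S × W} :
    ModelRel (A, 0) (∅, u) x ↔ x = (A, u) := by
  have : symmDiff A ∅ = A := symmDiff_bot A
  simp only [ModelRel, Prod.ext_iff, this, Set.union_empty, zero_add]
  constructor
  · rintro ⟨h1, h2, h3⟩
    exact ⟨subset_antisymm h3 h2, h1⟩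
  · rintro ⟨rfl, h1⟩
    exact ⟨h1, subset_rfl, subset_rfl⟩

variable {S W : Type*} [AddCommGroup W] [Module (ZMod 2) W]

theorem modelRel_self {p x : Set S × W} : ModelRel p p x ↔ x.2 = 0 ∧ x.1 ⊆ p.1 := by
  simp [ModelRel, ZModModule.add_self]

theorem modelRel_self_self {x : Set S × W} : ModelRel x x x ↔ x.2 = 0 := by
  simp [modelRel_self]

theorem fst_eq_empty_iff {x : Set S × W} :
    x.1 = ∅ ↔ ∀ y z, ModelRel x x y → ModelRel x x z → y = z := by
  simp only [modelRel_self]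
  constructor
  · rintro h y z ⟨hy, hy'⟩ ⟨hz, hz'⟩
    rw [h, Set.subset_empty_iff] at hy' hz'
    exact Prod.ext (hy'.trans hz'.symm) (hy.trans hz.symm)
  · intro h
    exact congrArg Prod.fst (h (x.1, 0) (∅, 0) ⟨rfl, subset_rfl⟩ ⟨rfl, Set.empty_subset _⟩)

/-- The action of permutations of `S` and linear automorphisms of `W` on `Set S × W`. -/
def modelHom (S W : Type*) [AddCommGroup W] [Module (ZMod 2) W] :
    Equiv.Perm S × (W ≃ₗ[ZMod 2] W) →* Equiv.Perm (Set S × W) where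
  toFun x := (Equiv.Set.congr x.1).prodCongr x.2.toEquiv
  map_one' := by ext1 ⟨A, u⟩; simp
  map_mul' x y := by
    ext1 ⟨A, u⟩
    simp [Set.image_image]

theorem modelHom_apply (x : Equiv.Perm S × (W ≃ₗ[ZMod 2] W)) (A : Set S) (u : W) :
    modelHom S W x (A, u) = (x.1 '' A, x.2 u) := rfl

theorem modelHom_injective : Function.Injective (modelHom S W) := by
  rintro ⟨π, g⟩ ⟨π', g'⟩ h
  have h' := fun A u => congrArg (fun σ => σ (A, u)) h
  simp only [modelHom_apply, Prod.mk.injEq] at h'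
  refine Prod.ext (Equiv.ext fun s => ?_) (LinearEquiv.ext fun u => (h' ∅ u).2)
  simpa using (h' {s} 0).1

theorem modelHom_preserves (x : Equiv.Perm S × (W ≃ₗ[ZMod 2] W)) (p q r : Set S × W) :
    ModelRel p q r ↔ ModelRel (modelHom S W x p) (modelHom S W x q) (modelHom S W x r) := by
  obtain ⟨A, u⟩ := p
  obtain ⟨B, v⟩ := q
  obtain ⟨C, w⟩ := r
  simp only [modelHom_apply, modelRel_mk, ← Set.image_symmDiff x.1.injective, ← Set.image_union,
    Set.image_subset_image_iff x.1.injective, ← map_add, x.2.injective.eq_iff]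

theorem exists_perm_of_orderIso (α : Set S ≃o Set S) :
    ∃ π : Equiv.Perm S, ∀ A, α A = π '' A := by
  have key : ∀ (β : Set S ≃o Set S) (s : S), ∃ t, β {s} = {t} := fun β s =>
    Set.isAtom_iff.1 ((OrderIso.isAtom_iff β _).2 (Set.isAtom_singleton s))
  choose f hf using key α
  choose g hg using key α.symm
  have hgf : ∀ s, g (f s) = s := fun s => by
    rw [← Set.singleton_eq_singleton_iff, ← hg, ← hf, OrderIso.symm_apply_apply]
  have hfg : ∀ s, f (g s) = s := fun s => by
    rw [← Set.singleton_eq_singleton_iff, ← hf, ← hg, OrderIso.apply_symm_apply]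
  refine ⟨⟨f, g, hgf, hfg⟩, fun A => ?_⟩
  ext t
  rw [Equiv.image_eq_preimage_symm, Set.mem_preimage, ← Set.singleton_subset_iff,
    ← Set.singleton_subset_iff]
  change {t} ≤ α A ↔ {g t} ≤ A
  rw [← hg, OrderIso.symm_apply_le]

theorem mem_range_modelHom {σ : Equiv.Perm (Set S × W)}
    (hσ : ∀ p q x, ModelRel p q x ↔ ModelRel (σ p) (σ q) (σ x)) : σ ∈ (modelHom S W).range := by
  have hσ' : ∀ p q x, ModelRel p q x ↔ ModelRel (σ.symm p) (σ.symm q) (σ.symm x) := fun p q x => by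
    simp [hσ (σ.symm p)]
  have snd_zero : ∀ τ : Equiv.Perm (Set S × W),
      (∀ p q x, ModelRel p q x ↔ ModelRel (τ p) (τ q) (τ x)) → ∀ A, (τ (A, 0)).2 = 0 :=
    fun τ hτ A => modelRel_self_self.1 ((hτ _ _ _).1 (modelRel_self_self.2 rfl))
  have fst_empty : ∀ τ : Equiv.Perm (Set S × W),
      (∀ p q x, ModelRel p q x ↔ ModelRel (τ p) (τ q) (τ x)) → ∀ u, (τ (∅, u)).1 = ∅ := by
    intro τ hτ u
    rw [fst_eq_empty_iff]
    intro y z hy hz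
    obtain ⟨y, rfl⟩ := τ.surjective y
    obtain ⟨z, rfl⟩ := τ.surjective z
    rw [← hτ] at hy hz
    rw [fst_eq_empty_iff.1 rfl y z hy hz]
  have eq_set : ∀ τ : Equiv.Perm (Set S × W),
      (∀ p q x, ModelRel p q x ↔ ModelRel (τ p) (τ q) (τ x)) →
        ∀ A, ((τ (A, 0)).1, (0 : W)) = τ (A, 0) :=
    fun τ hτ A => Prod.ext rfl (snd_zero τ hτ A).symm
  have eq_vec : ∀ τ : Equiv.Perm (Set S × W),
      (∀ p q x, ModelRel p q x ↔ ModelRel (τ p) (τ q) (τ x)) →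
        ∀ u, ((∅ : Set S), (τ (∅, u)).2) = τ (∅, u) :=
    fun τ hτ u => Prod.ext (fst_empty τ hτ u).symm rfl
  let α : Set S ≃o Set S :=
    { toFun := fun A => (σ (A, 0)).1
      invFun := fun A => (σ.symm (A, 0)).1
      left_inv := fun A => by
        change (σ.symm ((σ (A, 0)).1, 0)).1 = A
        rw [eq_set σ hσ, Equiv.symm_apply_apply]
      right_inv := fun A => by
        change (σ ((σ.symm (A, 0)).1, 0)).1 = A
        rw [eq_set σ.symm hσ', Equiv.apply_symm_apply]
      map_rel_iff' := by
        intro A B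
        have h := hσ (B, 0) (B, 0) (A, 0)
        rw [modelRel_self, modelRel_self] at h
        simpa [snd_zero σ hσ] using h.symm }
  obtain ⟨π, hπ⟩ := exists_perm_of_orderIso α
  let g₀ : W →+ W := AddMonoidHom.mk' (fun u => (σ (∅, u)).2) fun u v => by
    have h := (hσ _ _ _).1 (modelRel_empty (S := S) (u := u) (v := v).2 rfl)
    exact h.1
  have hg : Function.Bijective (g₀.toZModLinearMap 2) := by
    refine Function.bijective_iff_has_inverse.2 ⟨fun u => (σ.symm (∅, u)).2, fun u => ?_, fun u => ?_⟩
    · change (σ.symm (∅, (σ (∅, u)).2)).2 = u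
      rw [eq_vec σ hσ, Equiv.symm_apply_apply]
    · change (σ (∅, (σ.symm (∅, u)).2)).2 = u
      rw [eq_vec σ.symm hσ', Equiv.apply_symm_apply]
  refine ⟨(π, LinearEquiv.ofBijective _ hg), Equiv.ext fun ⟨A, u⟩ => ?_⟩
  have h := (hσ _ _ _).1 (modelRel_set_vec (A := A) (u := u).2 rfl)
  rw [← eq_set σ hσ, ← eq_vec σ hσ, modelRel_set_vec] at h
  rw [h, modelHom_apply, ← hπ]
  rfl

/-- A permutation group preserving a relation isomorphic to `ModelRel` is the product of a
symmetric and a general linear group. -/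
noncomputable def modelAutEquiv {X : Type*} (e : Set S × W ≃ X) (R : X → X → X → Prop)
    (he : ∀ p q x, ModelRel p q x ↔ R (e p) (e q) (e x)) (A : Subgroup (Equiv.Perm X))
    (hA : ∀ σ, σ ∈ A ↔ ∀ p q x, R p q x ↔ R (σ p) (σ q) (σ x)) :
    A ≃* Equiv.Perm S × (W ≃ₗ[ZMod 2] W) :=
  have hinj : Function.Injective (e.permCongrHom.toMonoidHom.comp (modelHom S W)) :=
    e.permCongrHom.injective.comp modelHom_injective
  have hrange : (e.permCongrHom.toMonoidHom.comp (modelHom S W)).range = A := by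
    ext σ
    have key : ∀ τ : Equiv.Perm (Set S × W), e.permCongrHom τ ∈ A ↔
        ∀ p q x, ModelRel p q x ↔ ModelRel (τ p) (τ q) (τ x) := by
      intro τ
      rw [hA]
      simp only [he, e.forall_congr_left, Equiv.permCongrHom, MulEquiv.coe_mk,
        Equiv.permCongr_apply, Equiv.apply_symm_apply]
    obtain ⟨τ, rfl⟩ := e.permCongrHom.surjective σ
    rw [key]
    constructor
    · rintro ⟨x, hx⟩
      have hx' : modelHom S W x = τ := e.permCongrHom.injective hx
      rw [← hx']
      exact modelHom_preserves x
    · intro h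
      obtain ⟨x, hx⟩ := mem_range_modelHom h
      exact ⟨x, congrArg e.permCongrHom hx⟩
  ((MonoidHom.ofInjective hinj).trans (MulEquiv.subgroupCongr hrange)).symm

/-- The linear automorphisms of a space of dimension `n` form the general linear group. -/
noncomputable def linearEquivMulEquivGL {n : ℕ} (b : Module.Basis (Fin n) (ZMod 2) W) :
    (W ≃ₗ[ZMod 2] W) ≃* Matrix.GeneralLinearGroup (Fin n) (ZMod 2) :=
  (LinearMap.GeneralLinearGroup.generalLinearEquiv (ZMod 2) W).symm.trans
    (Units.mapEquiv (LinearMap.toMatrixAlgEquiv b).toMulEquiv)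

end Model

end HyperPaper

namespace HyperPaper

namespace EA2Data

variable {H : Type*} (E : EA2Data H)

/-- The indices of the thick involutions occurring in the support of an element of `G`. -/
def thickSupport (G : Set H) : Set (Fin E.n) :=
  {i | E.hg.IsThick (E.q i) ∧ ∃ v, E.elt v ∈ G ∧ v i = 1}

variable {G : Set H}

theorem elt_mem_of_closed (hG : E.hg.IsClosed G) {w u v : Fin E.n → ZMod 2} (hu : E.elt u ∈ G) (hv : E.elt v ∈ G)
    (h : ∀ i, w i = u i + v i ∨ (E.hg.IsThick (E.q i) ∧ u i = 1 ∧ v i = 1)) : E.elt w ∈ G :=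
  hG.mul_mem hu hv (E.elt_mem_hmul_iff.2 h)

/-- The coordinate vectors of the thin elements of a closed subset. -/
def thinSpace (hG : E.hg.IsClosed G) : Submodule (ZMod 2) (Fin E.n → ZMod 2) where
  carrier := {v | E.elt v ∈ G ∧ ∀ i, E.hg.IsThick (E.q i) → v i = 0}
  zero_mem' := ⟨E.elt_zero ▸ hG.e_mem, fun _ _ => rfl⟩
  add_mem' := by
    rintro u v ⟨hu, hu'⟩ ⟨hv, hv'⟩
    exact ⟨E.elt_mem_of_closed hG hu hv fun i => .inl rfl,
      fun i hi => by simp [hu' i hi, hv' i hi]⟩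
  smul_mem' := by
    rintro c v ⟨hv, hv'⟩
    have two : ∀ a : ZMod 2, a = 0 ∨ a = 1 := by decide
    rcases two c with rfl | rfl
    · simpa [E.elt_zero] using hG.e_mem
    · simpa using ⟨hv, hv'⟩

theorem mem_thinSpace_iff (hG : E.hg.IsClosed G) {v : Fin E.n → ZMod 2} :
    v ∈ E.thinSpace hG ↔ E.elt v ∈ G ∧ ∀ i, E.hg.IsThick (E.q i) → v i = 0 := Iff.rfl

theorem elt_indicator_mem (hG : E.hg.IsClosed G) {F : Set (Fin E.n)} (hF : F ⊆ E.thickSupport G) :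
    E.elt (F.indicator 1) ∈ G := by
  induction F, F.toFinite using Set.Finite.induction_on with
  | empty => rw [Set.indicator_empty']; exact E.elt_zero ▸ hG.e_mem
  | @insert i F hi _ ih =>
    rw [Set.insert_subset_iff] at hF
    obtain ⟨⟨hthick, v, hv, hvi⟩, hF⟩ := hF
    have hs : E.elt (Pi.single i 1) ∈ G := by
      refine E.elt_mem_of_closed hG hv hv fun j => ?_
      by_cases hj : j = i
      · subst hj; exact .inr ⟨hthick, hvi, hvi⟩
      · left; simp [hj, CharTwo.add_self_eq_zero]
    refine E.elt_mem_of_closed hG hs (ih hF) fun j => .inl ?_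
    classical
    by_cases hj : j = i
    · subst hj; simp [hi]
    · simp [hj, Set.indicator_apply]

/-- The coordinate vector with thick part `A` and thin part `w`. -/
noncomputable def joinVec (hG : E.hg.IsClosed G)
    (p : Set (E.thickSupport G) × E.thinSpace hG) : Fin E.n → ZMod 2 :=
  (Subtype.val '' p.1 : Set (Fin E.n)).indicator 1 + (p.2 : Fin E.n → ZMod 2)

theorem joinVec_apply_of_mem (hG : E.hg.IsClosed G) (p) (i : E.thickSupport G) [Decidable (i ∈ p.1)] :
    E.joinVec hG p i = if i ∈ p.1 then 1 else 0 := by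
  classical
  simp [joinVec, (E.mem_thinSpace_iff hG).1 p.2.2 |>.2 i i.2.1, Set.indicator_apply]

theorem joinVec_apply_of_notMem (hG : E.hg.IsClosed G) (p) {i : Fin E.n}
    (hi : i ∉ E.thickSupport G) : E.joinVec hG p i = (p.2 : Fin E.n → ZMod 2) i := by
  simp [joinVec, hi]

theorem joinVec_injective (hG : E.hg.IsClosed G) : Function.Injective (E.joinVec hG) := by
  classical
  intro p r h
  refine Prod.ext (Set.ext fun i => ?_) (Subtype.ext (funext fun i => ?_))
  · have h' := congrFun h i
    rw [joinVec_apply_of_mem, joinVec_apply_of_mem] at h'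
    by_cases h1 : i ∈ p.1 <;> by_cases h2 : i ∈ r.1 <;> simp [h1, h2] at h' ⊢
  · by_cases hi : i ∈ E.thickSupport G
    · rw [p.2.2.2 i hi.1, r.2.2.2 i hi.1]
    · rw [← E.joinVec_apply_of_notMem hG p hi, ← E.joinVec_apply_of_notMem hG r hi, h]

theorem elt_joinVec_mem (hG : E.hg.IsClosed G) (p) : E.elt (E.joinVec hG p) ∈ G :=
  E.elt_mem_of_closed hG (E.elt_indicator_mem hG (Subtype.coe_image_subset _ p.1)) p.2.2.1 fun _ => .inl rfl

theorem exists_joinVec_eq (hG : E.hg.IsClosed G) {v : Fin E.n → ZMod 2} (hv : E.elt v ∈ G) :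
    ∃ p, E.joinVec hG p = v := by
  classical
  have two : ∀ a : ZMod 2, a ≠ 1 → a = 0 := by decide
  have hw : v + {i | E.hg.IsThick (E.q i) ∧ v i = 1}.indicator 1 ∈ E.thinSpace hG := by
    have hind : E.elt ({i | E.hg.IsThick (E.q i) ∧ v i = 1}.indicator 1) ∈ G :=
      E.elt_indicator_mem hG fun i hi => ⟨hi.1, v, hv, hi.2⟩
    refine ⟨E.elt_mem_of_closed hG hv hind fun i => .inl rfl, fun i hi => ?_⟩
    by_cases hvi : v i = 1
    · simp [hi, hvi, CharTwo.add_self_eq_zero]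
    · simp [two _ hvi]
  refine ⟨({i | v i = 1}, ⟨_, hw⟩), funext fun i => ?_⟩
  by_cases hi : i ∈ E.thickSupport G
  · have h := E.joinVec_apply_of_mem hG ({i | v i = 1}, ⟨_, hw⟩) ⟨i, hi⟩
    rw [h]
    by_cases hvi : v i = 1
    · simp [hvi]
    · simp [two _ hvi]
  · rw [E.joinVec_apply_of_notMem hG _ hi]
    have : ¬ (E.hg.IsThick (E.q i) ∧ v i = 1) := fun h => hi ⟨h.1, v, hv, h.2⟩
    simp [this]

/-- A closed subset is the product of its thick and its thin part. -/
noncomputable def joinEquiv (hG : E.hg.IsClosed G) :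
    Set (E.thickSupport G) × E.thinSpace hG ≃ G :=
  Equiv.ofBijective (fun p => ⟨E.elt (E.joinVec hG p), E.elt_joinVec_mem hG p⟩) <| by
    constructor
    · intro p r h
      exact E.joinVec_injective hG (E.elt_injective (Subtype.ext_iff.1 h))
    · rintro ⟨x, hx⟩
      obtain ⟨v, rfl⟩ := E.elt_surjective x
      obtain ⟨p, rfl⟩ := E.exists_joinVec_eq hG hx
      exact ⟨p, rfl⟩

theorem modelRel_iff_mem_hmul (hG : E.hg.IsClosed G) (p r x) :
    ModelRel p r x ↔ (E.joinEquiv hG x : H) ∈ E.hg.hmul (E.joinEquiv hG p) (E.joinEquiv hG r) := by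
  classical
  change _ ↔ E.elt (E.joinVec hG x) ∈ E.hg.hmul (E.elt (E.joinVec hG p)) (E.elt (E.joinVec hG r))
  rw [elt_mem_hmul_iff]
  have h11 : (1 + 1 : ZMod 2) = 0 := by decide
  have hthick : ∀ i : E.thickSupport G,
      (E.joinVec hG x i = E.joinVec hG p i + E.joinVec hG r i ∨
        (E.hg.IsThick (E.q i) ∧ E.joinVec hG p i = 1 ∧ E.joinVec hG r i = 1)) ↔
      (i ∈ symmDiff p.1 r.1 → i ∈ x.1) ∧ (i ∈ x.1 → i ∈ p.1 ∪ r.1) := by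
    intro i
    simp only [joinVec_apply_of_mem, i.2.1, true_and, Set.mem_symmDiff, Set.mem_union]
    by_cases h1 : i ∈ p.1 <;> by_cases h2 : i ∈ r.1 <;> by_cases h3 : i ∈ x.1 <;>
      simp [h1, h2, h3, h11]
  constructor
  · rintro ⟨h1, h2, h3⟩ i
    by_cases hi : i ∈ E.thickSupport G
    · exact (hthick ⟨i, hi⟩).2 ⟨fun h => h2 h, fun h => h3 h⟩
    · left
      simp only [E.joinVec_apply_of_notMem hG _ hi, h1]
      rfl
  · intro h
    refine ⟨Subtype.ext (funext fun i => ?_), fun i => ((hthick i).1 (h i)).1,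
      fun i => ((hthick i).1 (h i)).2⟩
    change (x.2 : Fin E.n → ZMod 2) i = (p.2 : Fin E.n → ZMod 2) i + (r.2 : Fin E.n → ZMod 2) i
    by_cases hi : E.hg.IsThick (E.q i)
    · simp [p.2.2.2 i hi, r.2.2.2 i hi, x.2.2.2 i hi]
    · have hi' : i ∉ E.thickSupport G := fun h => hi h.1
      simpa [E.joinVec_apply_of_notMem hG _ hi', hi] using h i

theorem mem_autGroup_iff (hG : E.hg.IsClosed G) (σ : Equiv.Perm G) :
    σ ∈ E.hg.autGroup G ↔
      ∀ p q x : G, (x : H) ∈ E.hg.hmul p q ↔ (σ x : H) ∈ E.hg.hmul (σ p) (σ q) := by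
  refine ⟨fun h => h.2, fun h => ⟨fun x hx => ?_, h⟩⟩
  have h1 := (h x (σ.symm ⟨E.hg.e, hG.e_mem⟩) (σ.symm ⟨E.hg.e, hG.e_mem⟩)).1
    (by rw [hx, E.hg.idl]; rfl)
  rw [Equiv.apply_symm_apply, E.hg.idr] at h1
  exact h1.symm

theorem sElem_elt (v : Fin E.n → ZMod 2) :
    E.sElem (E.elt v) = {i | E.hg.IsThick (E.q i) ∧ v i = 1}.ncard := by
  rw [sElem, support_elt, ← Set.ncard_image_of_injective _ E.q_injective]
  congr 1
  ext y
  constructor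
  · rintro ⟨⟨i, hi, rfl⟩, hy⟩
    exact ⟨i, ⟨hy, hi⟩, rfl⟩
  · rintro ⟨i, ⟨hy, hi⟩, rfl⟩
    exact ⟨⟨i, hi, rfl⟩, hy⟩

theorem sSet_eq (hG : E.hg.IsClosed G) : E.sSet G = Nat.card (E.thickSupport G) := by
  refine IsGreatest.csSup_eq ⟨⟨_, E.elt_indicator_mem hG subset_rfl, ?_⟩, ?_⟩
  · rw [sElem_elt, Nat.card_coe_set_eq]
    congr 1
    ext i
    by_cases hi : i ∈ E.thickSupport G
    · simp [hi, hi.1]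
    · simp [hi]
  · rintro k ⟨a, ha, rfl⟩
    obtain ⟨v, rfl⟩ := E.elt_surjective a
    rw [sElem_elt, Nat.card_coe_set_eq]
    exact Set.ncard_le_ncard fun i hi => ⟨hi.1, v, ha, hi.2⟩

theorem ncard_thinSpace_image (hG : E.hg.IsClosed G) :
    (E.elt '' (E.thinSpace hG : Set (Fin E.n → ZMod 2))).ncard =
      2 ^ Module.finrank (ZMod 2) (E.thinSpace hG) := by
  have h := Module.natCard_eq_pow_finrank (K := ZMod 2) (V := E.thinSpace hG)
  rw [Nat.card_zmod] at h
  rw [Set.ncard_image_of_injective _ E.elt_injective, ← h]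
  rfl

theorem rank2_eq (hG : E.hg.IsClosed G) :
    E.hg.rank2 G = Module.finrank (ZMod 2) (E.thinSpace hG) := by
  refine IsGreatest.csSup_eq ⟨⟨E.elt '' (E.thinSpace hG : Set (Fin E.n → ZMod 2)),
    ⟨⟨_, 0, zero_mem _, rfl⟩, ?_⟩, ?_, ?_, ?_, E.ncard_thinSpace_image hG⟩, ?_⟩
  · rintro x ⟨_, ⟨_, ⟨u, hu, rfl⟩, rfl⟩, _, ⟨v, hv, rfl⟩, hx⟩
    rw [star_elt] at hx
    obtain ⟨w, rfl⟩ := E.elt_surjective x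
    refine ⟨w, ?_, rfl⟩
    have hw : w = u + v := funext fun i => ((E.elt_mem_hmul_iff.1 hx) i).resolve_right
      fun ⟨hi, hui, _⟩ => by simp [hu.2 i hi] at hui
    exact hw ▸ add_mem hu hv
  · rintro _ ⟨v, hv, rfl⟩
    exact hv.1
  · rintro _ ⟨v, hv, rfl⟩
    exact (E.isThin_elt_iff v).2 hv.2
  · rintro _ ⟨v, -, rfl⟩
    exact E.star_elt v
  · rintro k ⟨U, -, hUG, hthin, -, hk⟩
    have hsub : U ⊆ E.elt '' (E.thinSpace hG : Set (Fin E.n → ZMod 2)) := by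
      intro x hx
      obtain ⟨v, rfl⟩ := E.elt_surjective x
      exact ⟨v, ⟨hUG hx, (E.isThin_elt_iff v).1 (hthin _ hx)⟩, rfl⟩
    have h := Set.ncard_le_ncard hsub ((Set.toFinite _).image _)
    rw [hk, ncard_thinSpace_image] at h
    exact (Nat.pow_le_pow_iff_right (by norm_num)).1 h

theorem nonempty_autGroup_mulEquiv (hG : E.hg.IsClosed G) :
    Nonempty ((E.hg.autGroup G) ≃* Equiv.Perm (Fin (E.sSet G)) ×
      Matrix.GeneralLinearGroup (Fin (E.hg.rank2 G)) (ZMod 2)) :=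
  ⟨(modelAutEquiv (E.joinEquiv hG) (fun p q x => (x : H) ∈ E.hg.hmul p q)
    (E.modelRel_iff_mem_hmul hG) _ (E.mem_autGroup_iff hG)).trans
      (MulEquiv.prodCongr (Finite.equivFinOfCardEq (E.sSet_eq hG).symm).permCongrHom
        (linearEquivMulEquivGL (Module.finBasisOfFinrankEq _ _ (E.rank2_eq hG).symm)))⟩

theorem isClosed_univ : E.hg.IsClosed Set.univ := ⟨⟨E.hg.e, trivial⟩, Set.subset_univ _⟩

theorem sSet_univ : E.sSet Set.univ = E.psharp := by
  rw [E.sSet_eq E.isClosed_univ, psharp, Nat.card_coe_set_eq]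
  congr 1
  ext i
  exact ⟨fun h => h.1, fun h => ⟨h, Pi.single i 1, trivial, by simp⟩⟩

theorem card_eq_two_pow : Nat.card H = 2 ^ E.n := by
  rw [← Nat.card_congr E.coord]
  simp

theorem rank2_univ : E.hg.rank2 Set.univ = E.n - E.psharp := by
  have h := Nat.card_congr ((E.joinEquiv E.isClosed_univ).trans (Equiv.Set.univ H))
  have hW := Module.natCard_eq_pow_finrank (K := ZMod 2) (V := E.thinSpace E.isClosed_univ)
  have hS : Nat.card (Set (E.thickSupport Set.univ)) = 2 ^ E.psharp := by
    have := Fintype.ofFinite (E.thickSupport Set.univ)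
    rw [← E.sSet_univ, E.sSet_eq E.isClosed_univ, Nat.card_eq_fintype_card,
      Nat.card_eq_fintype_card, Fintype.card_set]
  rw [Nat.card_prod, hW, hS, E.card_eq_two_pow, ← E.rank2_eq, Nat.card_zmod 2, ← pow_add] at h
  have := Nat.pow_right_injective le_rfl h
  omega

end EA2Data

end HyperPaper

/-- For a closed subset G of an elementary abelian 2-hypergroup H:
Aut(G) ≅ S_{s(G)} × GL(r_2(G), 2), and in particular
Aut(H) ≅ S_{p♯} × GL(p − p♯, 2). -/
theorem stmt17 {H : Type*} (E : EA2Data H) (G : Set H) (hG : E.hg.IsClosed G) :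
    Nonempty ((E.hg.autGroup G) ≃*
      Equiv.Perm (Fin (E.sSet G)) × Matrix.GeneralLinearGroup (Fin (E.hg.rank2 G)) (ZMod 2)) ∧
    Nonempty ((E.hg.autGroup (Set.univ : Set H)) ≃*
      Equiv.Perm (Fin E.psharp) ×
        Matrix.GeneralLinearGroup (Fin (E.n - E.psharp)) (ZMod 2)) := by
  refine ⟨E.nonempty_autGroup_mulEquiv hG, ?_⟩
  rw [← E.rank2_univ, ← E.sSet_univ]
  exact E.nonempty_autGroup_mulEquiv E.isClosed_univ
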